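/- arXiv:1907.12732 — 7 statements merged into one kernel-verified Lean document; each statement's English description precedes it below -/
import Mathlib

section
/- Let φ(t) = (2π)^{-1/2} exp(−t²/2) be the standard normal density, let a < b be real numbers with b − a ≤ 1, and set m = min{|a|, |b|}. Then (1/(b−a)) ∫_a^b φ(z) dz ≥ e^{−3/2} φ(m) if (b−a)·m ≤ 1, and (1/(b−a)) ∫_a^b φ(z) dz ≥ e^{−3/2} φ(m) / ((b−a)·m) if (b−a)·m > 1. Moreover, the same lower bounds hold with e^{−3/2} φ(m) replaced by e^{−2} · sup_{z ∈ [a,b]} φ(z), i.e. (1/(b−a)) ∫_a^b φ(z) dz ≥ e^{−2} · min{1, 1/((b−a)·m)} · sup_{z ∈ [a,b]} φ(z), where the factor min{1, 1/((b−a)·m)} is interpreted as 1 when m = 0. -/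
open MeasureTheory Real

/-- The standard normal density `φ(t) = (2π)^{-1/2} exp(−t²/2)`. -/
noncomputable def stdNormalPDF (t : ℝ) : ℝ :=
  (Real.sqrt (2 * Real.pi))⁻¹ * Real.exp (-t ^ 2 / 2)

theorem continuous_stdNormalPDF : Continuous stdNormalPDF := by
  unfold stdNormalPDF
  fun_prop

theorem stdNormalPDF_nonneg (t : ℝ) : 0 ≤ stdNormalPDF t := by
  unfold stdNormalPDF
  positivity

/-- Comparison of two values of the density through the squares of the arguments. -/
theorem exp_mul_stdNormalPDF_le {c x y : ℝ} (h : y ^ 2 ≤ x ^ 2 + 2 * c) :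
    Real.exp (-c) * stdNormalPDF x ≤ stdNormalPDF y := by
  unfold stdNormalPDF
  rw [mul_left_comm, ← Real.exp_add]
  gcongr
  linarith

/-- If `f` is nonnegative on `[a, b]` and at least `K` on a subinterval `[u, v]`, its integral
over `[a, b]` is at least `(v - u) * K`. -/
theorem sub_mul_le_integral_of_le_on_subinterval {f : ℝ → ℝ} (hf : Continuous f)
    (hf0 : ∀ z, 0 ≤ f z) {a b u v K : ℝ} (hau : a ≤ u) (huv : u ≤ v) (hvb : v ≤ b)
    (hK : ∀ z ∈ Set.Icc u v, K ≤ f z) :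
    (v - u) * K ≤ ∫ z in a..b, f z := by
  calc (v - u) * K = ∫ _ in u..v, K := by simp
    _ ≤ ∫ z in u..v, f z :=
      intervalIntegral.integral_mono_on huv (by simp) (hf.intervalIntegrable _ _) hK
    _ ≤ ∫ z in a..b, f z :=
      intervalIntegral.integral_mono_interval hau huv hvb (Filter.Eventually.of_forall hf0)
        (hf.intervalIntegrable _ _)

/-- The part of `[a, b]` of length `l` next to the endpoint closest to the origin carries mass
at least `l * (e^{-3/2} φ(m))`. -/
theorem mul_exp_mul_stdNormalPDF_le_integral {a b l : ℝ} (hl0 : 0 ≤ l) (hlab : l ≤ b - a)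
    (hl1 : l ≤ 1) (hlm : l * min |a| |b| ≤ 1) :
    l * (Real.exp (-(3 / 2)) * stdNormalPDF (min |a| |b|)) ≤
      ∫ z in a..b, stdNormalPDF z := by
  have key : ∀ c z : ℝ, l * |c| ≤ 1 → |z - c| ≤ l →
      Real.exp (-(3 / 2)) * stdNormalPDF |c| ≤ stdNormalPDF z := by
    intro c z hc hz
    apply exp_mul_stdNormalPDF_le
    have h : |z| ≤ |c| + l := by linarith [abs_sub_abs_le_abs_sub z c]
    nlinarith [sq_abs z, abs_nonneg z, abs_nonneg c]
  rcases min_choice |a| |b| with h | h <;> rw [h] at hlm ⊢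
  · have := sub_mul_le_integral_of_le_on_subinterval continuous_stdNormalPDF
      stdNormalPDF_nonneg (a := a) (b := b) (u := a) (v := a + l) le_rfl (by linarith)
      (by linarith) fun z hz => key a z hlm (abs_le.2 ⟨by linarith [hz.1], by linarith [hz.2]⟩)
    simpa using this
  · have := sub_mul_le_integral_of_le_on_subinterval continuous_stdNormalPDF
      stdNormalPDF_nonneg (a := a) (b := b) (u := b - l) (v := b) (by linarith) (by linarith)
      le_rfl fun z hz => key b z hlm (abs_le.2 ⟨by linarith [hz.1], by linarith [hz.2]⟩)
    simpa using this

/-- On an interval of length at most one, the supremum of the density exceeds its value at the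
endpoint closest to the origin by a factor of at most `e^{1/2}`. -/
theorem exp_mul_sSup_stdNormalPDF_le {a b : ℝ} (hab : a ≤ b) (hba : b - a ≤ 1) :
    Real.exp (-(1 / 2)) * sSup (stdNormalPDF '' Set.Icc a b) ≤
      stdNormalPDF (min |a| |b|) := by
  obtain ⟨z, hz, hsup⟩ := isCompact_Icc.exists_sSup_image_eq (Set.nonempty_Icc.2 hab)
    continuous_stdNormalPDF.continuousOn
  rw [hsup]
  apply exp_mul_stdNormalPDF_le
  obtain ⟨hz1, hz2⟩ := hz
  have hm0 : 0 ≤ min |a| |b| := by positivity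
  have ha := min_le_left |a| |b|
  have hb := min_le_right |a| |b|
  generalize min |a| |b| = m at *
  rcases le_total 0 a with h | h
  · rw [abs_of_nonneg h] at ha
    nlinarith
  rcases le_total b 0 with h' | h'
  · rw [abs_of_nonpos h'] at hb
    nlinarith
  · rw [abs_of_nonpos h] at ha
    rw [abs_of_nonneg h'] at hb
    nlinarith [sq_nonneg z]

/-- Lower bounds for the average of the standard normal density over an interval
`[a, b]` with `b − a ≤ 1`, in terms of `φ(m)` with `m = min{|a|, |b|}` and of
`sup_{z ∈ [a,b]} φ(z)`.  The factor `min{1, 1/((b−a)m)}` is written as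
`if (b−a)·m ≤ 1 then 1 else ((b−a)·m)⁻¹`, which agrees with the convention that
it equals `1` when `m = 0`. -/
theorem stmt_0 (a b : ℝ) (hab : a < b) (hba : b - a ≤ 1) (m : ℝ)
    (hm : m = min |a| |b|) :
    ((b - a) * m ≤ 1 →
      Real.exp (-(3 / 2)) * stdNormalPDF m ≤
        (b - a)⁻¹ * ∫ z in a..b, stdNormalPDF z) ∧
    (1 < (b - a) * m →
      Real.exp (-(3 / 2)) * stdNormalPDF m / ((b - a) * m) ≤
        (b - a)⁻¹ * ∫ z in a..b, stdNormalPDF z) ∧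
    Real.exp (-2) * (if (b - a) * m ≤ 1 then 1 else ((b - a) * m)⁻¹) *
        sSup (stdNormalPDF '' Set.Icc a b) ≤
      (b - a)⁻¹ * ∫ z in a..b, stdNormalPDF z := by
  subst hm
  have hd : 0 < b - a := sub_pos.2 hab
  set m := min |a| |b|
  have small : (b - a) * m ≤ 1 → Real.exp (-(3 / 2)) * stdNormalPDF m ≤
      (b - a)⁻¹ * ∫ z in a..b, stdNormalPDF z := fun h =>
    (le_inv_mul_iff₀ hd).2 (mul_exp_mul_stdNormalPDF_le_integral hd.le le_rfl hba h)
  have large : 1 < (b - a) * m → Real.exp (-(3 / 2)) * stdNormalPDF m / ((b - a) * m) ≤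
      (b - a)⁻¹ * ∫ z in a..b, stdNormalPDF z := by
    intro h
    have hm0 : 0 < m := pos_of_mul_pos_right (one_pos.trans h) hd.le
    have hlm : m⁻¹ ≤ b - a := (inv_le_iff_one_le_mul₀ hm0).2 h.le
    have := mul_exp_mul_stdNormalPDF_le_integral (inv_pos.2 hm0).le hlm (hlm.trans hba)
      (inv_mul_cancel₀ hm0.ne').le
    rw [div_eq_inv_mul, mul_inv, mul_assoc]
    gcongr
  refine ⟨small, large, ?_⟩
  have hsup : Real.exp (-2) * sSup (stdNormalPDF '' Set.Icc a b) ≤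
      Real.exp (-(3 / 2)) * stdNormalPDF m := by
    rw [show (-2 : ℝ) = -(3 / 2) + -(1 / 2) by norm_num, Real.exp_add, mul_assoc]
    gcongr
    exact exp_mul_sSup_stdNormalPDF_le hab.le hba
  split_ifs with h
  · rw [mul_one]
    exact hsup.trans (small h)
  · have h1 : 1 < (b - a) * m := not_le.1 h
    refine le_trans ?_ (large h1)
    rw [mul_right_comm, ← div_eq_mul_inv]
    gcongr
end

section
/- Let x₀ ∈ ℝ, h > 0, and let q : ℝ → ℝ be three times continuously differentiable on the interval [x₀ − h, x₀ + h]. Then |(1/h) ∫_{x₀−h}^{x₀+h} (x − x₀) q(x) dx − (2/3) h² q'(x₀)| ≤ (1/15) h⁴ · sup_{|c| ≤ 1} |q'''(x₀ + c h)|. -/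
open MeasureTheory Real Set

theorem iteratedDerivWithin_congr_subset {n : ℕ} {f : ℝ → ℝ} {s t : Set ℝ} {x : ℝ}
    (hst : s ⊆ t) (hs : UniqueDiffOn ℝ s) (ht : UniqueDiffOn ℝ t) (hf : ContDiffOn ℝ n f t)
    (hx : x ∈ s) : iteratedDerivWithin n f s x = iteratedDerivWithin n f t x := by
  rw [iteratedDerivWithin, iteratedDerivWithin, iteratedFDerivWithin_subset hst hs ht hf hx]

/-- Second-order Taylor bound with a base point `x₀` anywhere in `[a, b]`, where the derivatives
are taken within `[a, b]`. -/
theorem abs_sub_taylor_two_le {f : ℝ → ℝ} {a b x₀ x M : ℝ} (hab : a < b)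
    (hf : ContDiffOn ℝ 3 f (Icc a b)) (hx₀ : x₀ ∈ Icc a b) (hx : x ∈ Icc a b)
    (hM : ∀ y ∈ Icc a b, |iteratedDerivWithin 3 f (Icc a b) y| ≤ M) :
    |f x - (f x₀ + iteratedDerivWithin 1 f (Icc a b) x₀ * (x - x₀) +
        iteratedDerivWithin 2 f (Icc a b) x₀ / 2 * (x - x₀) ^ 2)| ≤ M / 6 * |x - x₀| ^ 3 := by
  rcases eq_or_ne x₀ x with rfl | hne
  · simp
  have hsub : uIcc x₀ x ⊆ Icc a b := uIcc_subset_Icc hx₀ hx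
  have hu : UniqueDiffOn ℝ (uIcc x₀ x) := uniqueDiffOn_uIcc hne
  have hderiv : ∀ k : ℕ, k ≤ 3 → ∀ y ∈ uIcc x₀ x,
      iteratedDerivWithin k f (uIcc x₀ x) y = iteratedDerivWithin k f (Icc a b) y :=
    fun k hk y hy ↦ iteratedDerivWithin_congr_subset hsub hu (uniqueDiffOn_Icc hab)
      (hf.of_le (mod_cast hk)) hy
  have hf' : ContDiffOn ℝ 3 f (uIcc x₀ x) := hf.mono hsub
  obtain ⟨y, hy, h⟩ := taylor_mean_remainder_lagrange (n := 2) hne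
    (hf'.of_le (by norm_num))
    ((hf'.differentiableOn_iteratedDerivWithin (by norm_num) hu).mono Ioo_subset_Icc_self)
  have hy' : y ∈ uIcc x₀ x := Ioo_subset_Icc_self hy
  rw [taylorWithinEval_succ, taylorWithinEval_succ, taylor_within_zero_eval,
    hderiv _ (by norm_num) _ left_mem_uIcc, hderiv _ (by norm_num) _ left_mem_uIcc,
    hderiv _ (by norm_num) _ hy'] at h
  norm_num [Nat.factorial, -iteratedDerivWithin_one] at h
  calc _ = |iteratedDerivWithin 3 f (Icc a b) y * (x - x₀) ^ 3 / 6| := by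
        rw [← h]; congr 1; ring
    _ = |iteratedDerivWithin 3 f (Icc a b) y| / 6 * |x - x₀| ^ 3 := by
        rw [abs_div, abs_mul, abs_pow, abs_of_pos (by norm_num : (0 : ℝ) < 6)]; ring
    _ ≤ _ := by gcongr; exact hM y (hsub hy')

/-- The first moment over a symmetric interval of a function that is within `C |x - x₀| ^ 3` of a
quadratic polynomial. -/
theorem abs_integral_moment_sub_le {f : ℝ → ℝ} {x₀ h c₀ c₁ c₂ C : ℝ} (hh : 0 ≤ h)
    (hf : ContinuousOn f (Icc (x₀ - h) (x₀ + h)))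
    (hC : ∀ x ∈ Icc (x₀ - h) (x₀ + h),
      |f x - (c₀ + c₁ * (x - x₀) + c₂ * (x - x₀) ^ 2)| ≤ C * |x - x₀| ^ 3) :
    |(∫ x in (x₀ - h)..(x₀ + h), (x - x₀) * f x) - 2 / 3 * h ^ 3 * c₁| ≤
      2 / 5 * h ^ 5 * C := by
  have hle : x₀ - h ≤ x₀ + h := by linarith
  have hpoly : ∫ x in (x₀ - h)..(x₀ + h),
      (x - x₀) * (c₀ + c₁ * (x - x₀) + c₂ * (x - x₀) ^ 2) = 2 / 3 * h ^ 3 * c₁ := by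
    rw [intervalIntegral.integral_comp_sub_right
      (fun t ↦ t * (c₀ + c₁ * t + c₂ * t ^ 2)) x₀]
    have e : ∀ t : ℝ, t * (c₀ + c₁ * t + c₂ * t ^ 2) = c₀ * t ^ 1 + c₁ * t ^ 2 + c₂ * t ^ 3 :=
      fun t ↦ by ring
    simp_rw [e]
    rw [intervalIntegral.integral_add (Continuous.intervalIntegrable (by fun_prop) _ _)
        (Continuous.intervalIntegrable (by fun_prop) _ _),
      intervalIntegral.integral_add (Continuous.intervalIntegrable (by fun_prop) _ _)
        (Continuous.intervalIntegrable (by fun_prop) _ _)]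
    simp only [intervalIntegral.integral_const_mul, integral_pow]
    norm_num
    ring
  have hquartic : ∫ x in (x₀ - h)..(x₀ + h), C * (x - x₀) ^ 4 = 2 / 5 * h ^ 5 * C := by
    rw [intervalIntegral.integral_comp_sub_right (fun t ↦ C * t ^ 4) x₀]
    simp only [intervalIntegral.integral_const_mul, integral_pow]
    norm_num
    ring
  rw [← hpoly, ← hquartic, ← intervalIntegral.integral_sub
    (ContinuousOn.intervalIntegrable (by rw [uIcc_of_le hle]; fun_prop))
    (Continuous.intervalIntegrable (by fun_prop) _ _)]
  rw [← Real.norm_eq_abs]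
  refine intervalIntegral.norm_integral_le_of_norm_le hle (.of_forall fun x hx ↦ ?_)
    (by apply Continuous.intervalIntegrable; fun_prop)
  rw [← mul_sub, norm_mul, Real.norm_eq_abs, Real.norm_eq_abs]
  calc _ ≤ |x - x₀| * (C * |x - x₀| ^ 3) := by gcongr; exact hC x (Ioc_subset_Icc_self hx)
    _ = C * |x - x₀| ^ 4 := by ring
    _ = C * (x - x₀) ^ 4 := by rw [Even.pow_abs (by decide)]



/-- Local first-moment accuracy: if `q` is three times continuously
differentiable on `[x₀ − h, x₀ + h]`, then
`|(1/h) ∫_{x₀−h}^{x₀+h} (x − x₀) q(x) dx − (2/3) h² q'(x₀)|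
  ≤ (1/15) h⁴ sup_{|c| ≤ 1} |q'''(x₀ + c h)|`,
where `q'` and `q'''` are the first and third derivatives of `q` on the interval. -/
theorem stmt_3 (x₀ h : ℝ) (hh : 0 < h) (q : ℝ → ℝ)
    (hq : ContDiffOn ℝ 3 q (Set.Icc (x₀ - h) (x₀ + h))) :
    |(1 / h) * (∫ x in (x₀ - h)..(x₀ + h), (x - x₀) * q x) -
        (2 / 3) * h ^ 2 * iteratedDerivWithin 1 q (Set.Icc (x₀ - h) (x₀ + h)) x₀| ≤
      (1 / 15) * h ^ 4 *
        sSup ((fun c =>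
          |iteratedDerivWithin 3 q (Set.Icc (x₀ - h) (x₀ + h)) (x₀ + c * h)|) ''
            Set.Icc (-1 : ℝ) 1) := by
  set I := Icc (x₀ - h) (x₀ + h)
  have hlt : x₀ - h < x₀ + h := by linarith
  have hcont : ContinuousOn (iteratedDerivWithin 3 q I) I :=
    hq.continuousOn_iteratedDerivWithin (by norm_num) (uniqueDiffOn_Icc hlt)
  have hmaps : MapsTo (fun c ↦ x₀ + c * h) (Icc (-1 : ℝ) 1) I := fun c hc ↦
    ⟨by nlinarith [hc.1], by nlinarith [hc.2]⟩
  set M := sSup ((fun c ↦ |iteratedDerivWithin 3 q I (x₀ + c * h)|) '' Icc (-1 : ℝ) 1)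
  have hbdd : BddAbove ((fun c ↦ |iteratedDerivWithin 3 q I (x₀ + c * h)|) '' Icc (-1 : ℝ) 1) :=
    isCompact_Icc.bddAbove_image (hcont.comp (by fun_prop) hmaps).abs
  have hM : ∀ y ∈ I, |iteratedDerivWithin 3 q I y| ≤ M := fun y hy ↦ by
    refine le_csSup hbdd ⟨(y - x₀) / h, ⟨?_, ?_⟩, ?_⟩
    · rw [le_div_iff₀ hh]; linarith [hy.1]
    · rw [div_le_iff₀ hh]; linarith [hy.2]
    · simp [div_mul_cancel₀ _ hh.ne']
  have hx₀ : x₀ ∈ I := ⟨by linarith, by linarith⟩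
  have key := abs_integral_moment_sub_le hh.le hq.continuousOn
    fun x hx ↦ abs_sub_taylor_two_le hlt hq hx₀ hx hM
  calc _ = 1 / h * |(∫ x in (x₀ - h)..(x₀ + h), (x - x₀) * q x) -
          2 / 3 * h ^ 3 * iteratedDerivWithin 1 q I x₀| := by
        rw [← abs_of_pos (one_div_pos.2 hh), ← abs_mul, abs_of_pos (one_div_pos.2 hh)]
        congr 1
        field_simp
    _ ≤ 1 / h * (2 / 5 * h ^ 5 * (M / 6)) := by gcongr
    _ = 1 / 15 * h ^ 4 * M := by field_simp; ring
end

section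
/- Let x₀ ∈ ℝ, h > 0, and let q : ℝ → ℝ be twice continuously differentiable on the interval [x₀ − h, x₀ + h]. Then |(1/h) ∫_{x₀−h}^{x₀+h} (x − x₀)² q(x) dx − (2/3) h² q(x₀)| ≤ (4/5) h⁴ · sup_{|c| ≤ 1} |q''(x₀ + c h)|. -/
open MeasureTheory Real Set

/-- Quadratic bound for the first-order Taylor remainder on an interval, with expansion point
anywhere in the interval. -/
theorem abs_sub_taylor_one_le {a b x₀ x M : ℝ} (hab : a < b) {q : ℝ → ℝ}
    (hq : ContDiffOn ℝ 2 q (Icc a b))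
    (hM : ∀ y ∈ Icc a b, |iteratedDerivWithin 2 q (Icc a b) y| ≤ M)
    (hx₀ : x₀ ∈ Icc a b) (hx : x ∈ Icc a b) :
    |q x - (q x₀ + derivWithin q (Icc a b) x₀ * (x - x₀))| ≤ M * (x - x₀) ^ 2 := by
  have hu : UniqueDiffOn ℝ (Icc a b) := uniqueDiffOn_Icc hab
  have hM0 : 0 ≤ M := (abs_nonneg _).trans (hM x₀ hx₀)
  have hq1 : ∀ y ∈ Icc a b, HasDerivWithinAt q (derivWithin q (Icc a b) y) (Icc a b) y :=
    fun y hy => (hq.differentiableOn (by norm_num) y hy).hasDerivWithinAt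
  have hq2 : ∀ y ∈ Icc a b, HasDerivWithinAt (derivWithin q (Icc a b))
      (iteratedDerivWithin 2 q (Icc a b) y) (Icc a b) y := by
    intro y hy
    have hd := (hq.differentiableOn_iteratedDerivWithin (m := 1) (by norm_num) hu y hy)
    rw [iteratedDerivWithin_succ, iteratedDerivWithin_one]
    rw [iteratedDerivWithin_one] at hd
    exact hd.hasDerivWithinAt
  have hsub : uIcc x₀ x ⊆ Icc a b := uIcc_subset_Icc hx₀ hx
  have hbound : ∀ y ∈ uIcc x₀ x,
      ‖derivWithin q (Icc a b) y - derivWithin q (Icc a b) x₀‖ ≤ M * |x - x₀| := by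
    intro y hy
    refine ((convex_Icc a b).norm_image_sub_le_of_norm_hasDerivWithin_le hq2 hM hx₀
      (hsub hy)).trans ?_
    exact mul_le_mul_of_nonneg_left (abs_sub_left_of_mem_uIcc hy) hM0
  have hg : ∀ y ∈ uIcc x₀ x, HasDerivWithinAt
      (fun y => q y - derivWithin q (Icc a b) x₀ * y)
      (derivWithin q (Icc a b) y - derivWithin q (Icc a b) x₀) (uIcc x₀ x) y := by
    intro y hy
    have hd := ((hq1 y (hsub hy)).mono hsub).sub
      ((hasDerivWithinAt_id y (uIcc x₀ x)).const_mul (derivWithin q (Icc a b) x₀))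
    rw [mul_one] at hd
    exact hd
  have key := (convex_uIcc x₀ x).norm_image_sub_le_of_norm_hasDerivWithin_le hg hbound
    left_mem_uIcc right_mem_uIcc
  rw [Real.norm_eq_abs, Real.norm_eq_abs, mul_assoc, abs_mul_abs_self, ← sq] at key
  convert key using 2
  ring

/-- The second moment of an affine function about the centre of a symmetric interval. -/
theorem integral_sq_mul_affine (x₀ h A B : ℝ) :
    ∫ x in (x₀ - h)..(x₀ + h), (x - x₀) ^ 2 * (A + B * (x - x₀)) = 2 / 3 * h ^ 3 * A := by
  rw [intervalIntegral.integral_comp_sub_right (fun t => t ^ 2 * (A + B * t)) x₀]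
  have e : ∀ t : ℝ, t ^ 2 * (A + B * t) = A * t ^ 2 + B * t ^ 3 := fun t => by ring
  simp_rw [e]
  rw [intervalIntegral.integral_add (Continuous.intervalIntegrable (by fun_prop) _ _)
    (Continuous.intervalIntegrable (by fun_prop) _ _)]
  simp only [intervalIntegral.integral_const_mul, integral_pow]
  norm_num
  ring

/-- Local second-moment accuracy: if `q` is twice continuously differentiable on
`[x₀ − h, x₀ + h]`, then
`|(1/h) ∫_{x₀−h}^{x₀+h} (x − x₀)² q(x) dx − (2/3) h² q(x₀)|
  ≤ (4/5) h⁴ sup_{|c| ≤ 1} |q''(x₀ + c h)|`,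
where `q''` is the second derivative of `q` on the interval. -/
theorem stmt_4 (x₀ h : ℝ) (hh : 0 < h) (q : ℝ → ℝ)
    (hq : ContDiffOn ℝ 2 q (Set.Icc (x₀ - h) (x₀ + h))) :
    |(1 / h) * (∫ x in (x₀ - h)..(x₀ + h), (x - x₀) ^ 2 * q x) -
        (2 / 3) * h ^ 2 * q x₀| ≤
      (4 / 5) * h ^ 4 *
        sSup ((fun c =>
          |iteratedDerivWithin 2 q (Set.Icc (x₀ - h) (x₀ + h)) (x₀ + c * h)|) ''
            Set.Icc (-1 : ℝ) 1) := by
  have hab : x₀ - h < x₀ + h := by linarith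
  have hx₀ : x₀ ∈ Icc (x₀ - h) (x₀ + h) := ⟨by linarith, by linarith⟩
  set M := sSup ((fun c =>
    |iteratedDerivWithin 2 q (Icc (x₀ - h) (x₀ + h)) (x₀ + c * h)|) '' Icc (-1 : ℝ) 1)
  have hcont : ContinuousOn (fun c =>
      |iteratedDerivWithin 2 q (Icc (x₀ - h) (x₀ + h)) (x₀ + c * h)|) (Icc (-1 : ℝ) 1) := by
    refine ContinuousOn.abs ((hq.continuousOn_iteratedDerivWithin le_rfl
      (uniqueDiffOn_Icc hab)).comp (by fun_prop) fun c hc => ⟨?_, ?_⟩)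
    · nlinarith [hc.1]
    · nlinarith [hc.2]
  have hM : ∀ y ∈ Icc (x₀ - h) (x₀ + h),
      |iteratedDerivWithin 2 q (Icc (x₀ - h) (x₀ + h)) y| ≤ M := by
    intro y hy
    refine le_csSup (isCompact_Icc.image_of_continuousOn hcont).bddAbove
      ⟨(y - x₀) / h, ⟨?_, ?_⟩, ?_⟩
    · rw [le_div_iff₀ hh]; linarith [hy.1]
    · rw [div_le_iff₀ hh]; linarith [hy.2]
    · simp only [div_mul_cancel₀ _ hh.ne', add_sub_cancel]
  have hM0 : 0 ≤ M := (abs_nonneg _).trans (hM x₀ hx₀)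
  set B := derivWithin q (Icc (x₀ - h) (x₀ + h)) x₀
  have hint : IntervalIntegrable (fun x => (x - x₀) ^ 2 * q x) volume (x₀ - h) (x₀ + h) := by
    refine ContinuousOn.intervalIntegrable ?_
    rw [uIcc_of_le hab.le]
    exact ContinuousOn.mul (by fun_prop) hq.continuousOn
  have hrem : |∫ x in (x₀ - h)..(x₀ + h),
      ((x - x₀) ^ 2 * q x - (x - x₀) ^ 2 * (q x₀ + B * (x - x₀)))| ≤ 2 / 5 * h ^ 5 * M := by
    have hquart : ∫ x in (x₀ - h)..(x₀ + h), M * (x - x₀) ^ 4 = 2 / 5 * h ^ 5 * M := by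
      rw [intervalIntegral.integral_comp_sub_right (fun t => M * t ^ 4) x₀,
        intervalIntegral.integral_const_mul, integral_pow]
      norm_num
      ring
    rw [← hquart, ← Real.norm_eq_abs]
    refine intervalIntegral.norm_integral_le_of_norm_le hab.le
      (Filter.Eventually.of_forall fun x hx => ?_)
      (Continuous.intervalIntegrable (by fun_prop) _ _)
    rw [← mul_sub, Real.norm_eq_abs, abs_mul, abs_of_nonneg (sq_nonneg (x - x₀))]
    calc (x - x₀) ^ 2 * |q x - (q x₀ + B * (x - x₀))|
        ≤ (x - x₀) ^ 2 * (M * (x - x₀) ^ 2) :=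
          mul_le_mul_of_nonneg_left
            (abs_sub_taylor_one_le hab hq hM hx₀ (Ioc_subset_Icc_self hx)) (sq_nonneg _)
      _ = M * (x - x₀) ^ 4 := by ring
  rw [intervalIntegral.integral_sub hint (Continuous.intervalIntegrable (by fun_prop) _ _),
    integral_sq_mul_affine] at hrem
  have hscale : ∀ I : ℝ, 1 / h * I - 2 / 3 * h ^ 2 * q x₀
      = 1 / h * (I - 2 / 3 * h ^ 3 * q x₀) := fun I => by field_simp
  rw [hscale, abs_mul, abs_of_pos (one_div_pos.mpr hh)]
  calc 1 / h * _ ≤ 1 / h * (2 / 5 * h ^ 5 * M) :=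
        mul_le_mul_of_nonneg_left hrem (one_div_pos.mpr hh).le
    _ = 2 / 5 * h ^ 4 * M := by field_simp
    _ ≤ 4 / 5 * h ^ 4 * M := by
        gcongr
        norm_num
end

section
/- Let x₀ ∈ ℝ, h > 0, and let q : ℝ → ℝ be three times continuously differentiable on the interval [x₀ − h, x₀ + h]. Then |(1/h) ∫_{x₀−h}^{x₀+h} (x − x₀)³ q(x) dx − (2/5) h⁴ q'(x₀)| ≤ (1/21) h⁶ · sup_{|c| ≤ 1} |q'''(x₀ + c h)|. -/
open MeasureTheory Real Set

/-- If `g` vanishes at `x₀` and its derivative is bounded by `C * |x - x₀| ^ n` on a convex set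
containing `x₀`, then `g` is bounded by `C * |x - x₀| ^ (n + 1) / (n + 1)` there. -/
theorem abs_le_of_abs_deriv_le_pow {s : Set ℝ} (hs : Convex ℝ s) {g g' : ℝ → ℝ} {x₀ C : ℝ} {n : ℕ}
    (hx₀ : x₀ ∈ s) (hg : ∀ x ∈ s, HasDerivWithinAt g (g' x) s x) (hg₀ : g x₀ = 0)
    (bound : ∀ x ∈ s, |g' x| ≤ C * |x - x₀| ^ n) {x : ℝ} (hx : x ∈ s) :
    |g x| ≤ C * |x - x₀| ^ (n + 1) / (n + 1) := by
  have hmaps : MapsTo (fun t : ℝ => x₀ + t * (x - x₀)) (Icc 0 1) s := fun t ht => by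
    have := hs.add_smul_sub_mem hx₀ hx ht
    simpa using this
  have hderiv : ∀ t ∈ Icc (0 : ℝ) 1, HasDerivWithinAt (fun t => g (x₀ + t * (x - x₀)))
      (g' (x₀ + t * (x - x₀)) * (x - x₀)) (Icc 0 1) t := fun t ht => by
    have hline : HasDerivWithinAt (fun t : ℝ => x₀ + t * (x - x₀)) (x - x₀) (Icc 0 1) t := by
      simpa using (((hasDerivAt_id t).mul_const (x - x₀)).const_add x₀).hasDerivWithinAt
    exact (hg _ (hmaps ht)).comp t hline hmaps
  have hB : ∀ t : ℝ, HasDerivAt (fun t => C * |x - x₀| ^ (n + 1) / (n + 1) * t ^ (n + 1))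
      (C * |x - x₀| ^ (n + 1) * t ^ n) t := fun t => by
    refine ((hasDerivAt_pow (n + 1) t).const_mul _).congr_deriv ?_
    have : (n + 1 : ℝ) ≠ 0 := by positivity
    push_cast
    field_simp
  have key := image_norm_le_of_norm_deriv_right_le_deriv_boundary
    (f := fun t => g (x₀ + t * (x - x₀))) (a := 0) (b := 1)
    (fun t ht => (hderiv t ht).continuousWithinAt)
    (fun t ht => (hderiv t (Ico_subset_Icc_self ht)).mono_of_mem_nhdsWithin
      (Icc_mem_nhdsGE_of_mem ht)) (by simp [hg₀]) hB
    (fun t ht => by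
      have h1 := bound _ (hmaps (Ico_subset_Icc_self ht))
      rw [add_sub_cancel_left, abs_mul, abs_of_nonneg ht.1] at h1
      rw [Real.norm_eq_abs, abs_mul]
      calc _ ≤ C * (t * |x - x₀|) ^ n * |x - x₀| := by gcongr
        _ = _ := by ring)
    (right_mem_Icc.2 zero_le_one)
  simpa using key

/-- Second-order Taylor estimate on a convex set, around any of its points. -/
theorem abs_sub_taylor_two_le_s5 {s : Set ℝ} (hs : Convex ℝ s) {f f₁ f₂ f₃ : ℝ → ℝ} {x₀ M : ℝ}
    (hx₀ : x₀ ∈ s) (hf : ∀ x ∈ s, HasDerivWithinAt f (f₁ x) s x)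
    (hf₁ : ∀ x ∈ s, HasDerivWithinAt f₁ (f₂ x) s x)
    (hf₂ : ∀ x ∈ s, HasDerivWithinAt f₂ (f₃ x) s x)
    (bound : ∀ x ∈ s, |f₃ x| ≤ M) {x : ℝ} (hx : x ∈ s) :
    |f x - (f x₀ + f₁ x₀ * (x - x₀) + f₂ x₀ / 2 * (x - x₀) ^ 2)| ≤ M / 6 * |x - x₀| ^ 3 := by
  have hsub (x : ℝ) : HasDerivWithinAt (fun y => y - x₀) 1 s x :=
    ((hasDerivAt_id x).sub_const x₀).hasDerivWithinAt
  have h₂ : ∀ x ∈ s, |f₂ x - f₂ x₀| ≤ M * |x - x₀| ^ 1 := fun x hx => by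
    have := abs_le_of_abs_deriv_le_pow hs (g := fun x => f₂ x - f₂ x₀) (n := 0) (C := M) hx₀
      (fun x hx => (hf₂ x hx).sub_const _) (by simp) (by simpa using bound) hx
    simpa using this
  have h₁ : ∀ x ∈ s, |f₁ x - (f₁ x₀ + f₂ x₀ * (x - x₀))| ≤ M / 2 * |x - x₀| ^ 2 := fun x hx => by
    have := abs_le_of_abs_deriv_le_pow hs (g := fun x => f₁ x - (f₁ x₀ + f₂ x₀ * (x - x₀))) hx₀
      (fun x hx => ((hf₁ x hx).sub
        (((hsub x).const_mul (f₂ x₀)).const_add (f₁ x₀))).congr_deriv (by rw [mul_one]))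
      (by simp) h₂ hx
    refine this.trans_eq ?_
    push_cast
    ring
  have := abs_le_of_abs_deriv_le_pow hs
    (g := fun x => f x - (f x₀ + f₁ x₀ * (x - x₀) + f₂ x₀ / 2 * (x - x₀) ^ 2)) hx₀
    (fun x hx => ((hf x hx).sub ((((hsub x).const_mul (f₁ x₀)).const_add (f x₀)).add
      (((hsub x).pow 2).const_mul (f₂ x₀ / 2)))).congr_deriv
        (g' := f₁ x - (f₁ x₀ + f₂ x₀ * (x - x₀))) (by norm_num; ring))
    (by simp) h₁ hx
  refine this.trans_eq ?_
  push_cast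
  ring

/-- A function with a second-order Taylor estimate has third moment on a symmetric interval close
to that of its Taylor polynomial. -/
theorem abs_integral_pow_three_mul_sub_le {f : ℝ → ℝ} {a b c M h : ℝ} (hh : 0 ≤ h)
    (hf : ContinuousOn f (Icc (-h) h))
    (bound : ∀ t ∈ Icc (-h) h, |f t - (a + b * t + c * t ^ 2)| ≤ M / 6 * |t| ^ 3) :
    |(∫ t in (-h)..h, t ^ 3 * f t) - 2 / 5 * h ^ 5 * b| ≤ 1 / 21 * h ^ 7 * M := by
  have hle : -h ≤ h := by linarith
  have hpoly : ∫ t in (-h)..h, t ^ 3 * (a + b * t + c * t ^ 2) = 2 / 5 * h ^ 5 * b := by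
    have hexp : ∀ t : ℝ, t ^ 3 * (a + b * t + c * t ^ 2) = a * t ^ 3 + b * t ^ 4 + c * t ^ 5 :=
      fun t => by ring
    simp_rw [hexp]
    rw [intervalIntegral.integral_add, intervalIntegral.integral_add]
    · simp only [intervalIntegral.integral_const_mul, integral_pow]
      norm_num
      ring
    all_goals exact Continuous.intervalIntegrable (by fun_prop) _ _
  have hint : IntervalIntegrable (fun t => t ^ 3 * f t) volume (-h) h :=
    ContinuousOn.intervalIntegrable_of_Icc hle (by fun_prop)
  rw [← hpoly, ← intervalIntegral.integral_sub hint
    (Continuous.intervalIntegrable (by fun_prop) _ _), ← Real.norm_eq_abs]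
  calc _ ≤ ∫ t in (-h)..h, M / 6 * t ^ 6 := by
        refine intervalIntegral.norm_integral_le_of_norm_le hle (.of_forall fun t ht => ?_)
          (Continuous.intervalIntegrable (by fun_prop) _ _)
        rw [← mul_sub, Real.norm_eq_abs, abs_mul, abs_pow]
        calc _ ≤ |t| ^ 3 * (M / 6 * |t| ^ 3) := by
              gcongr
              exact bound t (Ioc_subset_Icc_self ht)
          _ = M / 6 * |t| ^ 6 := by ring
          _ = _ := by rw [Even.pow_abs (by decide)]
    _ = _ := by
        rw [intervalIntegral.integral_const_mul, integral_pow]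
        norm_num
        ring

/-- Local third-moment accuracy: if `q` is three times continuously
differentiable on `[x₀ − h, x₀ + h]`, then
`|(1/h) ∫_{x₀−h}^{x₀+h} (x − x₀)³ q(x) dx − (2/5) h⁴ q'(x₀)|
  ≤ (1/21) h⁶ sup_{|c| ≤ 1} |q'''(x₀ + c h)|`,
where `q'` and `q'''` are the first and third derivatives of `q` on the interval. -/
theorem stmt_5 (x₀ h : ℝ) (hh : 0 < h) (q : ℝ → ℝ)
    (hq : ContDiffOn ℝ 3 q (Set.Icc (x₀ - h) (x₀ + h))) :
    |(1 / h) * (∫ x in (x₀ - h)..(x₀ + h), (x - x₀) ^ 3 * q x) -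
        (2 / 5) * h ^ 4 * iteratedDerivWithin 1 q (Set.Icc (x₀ - h) (x₀ + h)) x₀| ≤
      (1 / 21) * h ^ 6 *
        sSup ((fun c =>
          |iteratedDerivWithin 3 q (Set.Icc (x₀ - h) (x₀ + h)) (x₀ + c * h)|) ''
            Set.Icc (-1 : ℝ) 1) := by
  set s := Icc (x₀ - h) (x₀ + h)
  set M := sSup ((fun c => |iteratedDerivWithin 3 q s (x₀ + c * h)|) '' Icc (-1 : ℝ) 1)
  have hs : UniqueDiffOn ℝ s := uniqueDiffOn_Icc (by linarith)
  have hx₀ : x₀ ∈ s := ⟨by linarith, by linarith⟩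
  have hderiv (k : ℕ) (hk : k < 3) : ∀ x ∈ s,
      HasDerivWithinAt (iteratedDerivWithin k q s) (iteratedDerivWithin (k + 1) q s x) s x :=
    fun x hx => by
      rw [iteratedDerivWithin_succ]
      exact (hq.differentiableOn_iteratedDerivWithin (mod_cast hk) hs x hx).hasDerivWithinAt
  have hbdd : BddAbove ((fun c => |iteratedDerivWithin 3 q s (x₀ + c * h)|) '' Icc (-1 : ℝ) 1) := by
    refine isCompact_Icc.bddAbove_image (ContinuousOn.abs ?_)
    refine (hq.continuousOn_iteratedDerivWithin (m := 3) le_rfl hs).comp (by fun_prop) ?_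
    exact fun c hc => ⟨by nlinarith [hc.1], by nlinarith [hc.2]⟩
  have hbound : ∀ x ∈ s, |iteratedDerivWithin 3 q s x| ≤ M := fun x hx => by
    refine le_csSup hbdd ⟨(x - x₀) / h, ⟨?_, ?_⟩, ?_⟩
    · rw [le_div_iff₀ hh]; linarith [hx.1]
    · rw [div_le_iff₀ hh]; linarith [hx.2]
    · simp [div_mul_cancel₀ _ hh.ne']
  have hshift : MapsTo (fun t => x₀ + t) (Icc (-h) h) s :=
    fun t ht => ⟨by linarith [ht.1], by linarith [ht.2]⟩
  have hmoment := abs_integral_pow_three_mul_sub_le (f := fun t => q (x₀ + t)) hh.le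
    (hq.continuousOn.comp (by fun_prop) hshift) (fun t ht => by
      simpa only [iteratedDerivWithin_zero, add_sub_cancel_left] using
        abs_sub_taylor_two_le_s5 (convex_Icc _ _) hx₀ (hderiv 0 (by norm_num))
          (hderiv 1 (by norm_num)) (hderiv 2 (by norm_num)) hbound (hshift ht))
  have hsubst : ∫ x in (x₀ - h)..(x₀ + h), (x - x₀) ^ 3 * q x =
      ∫ t in (-h)..h, t ^ 3 * q (x₀ + t) := by
    have := intervalIntegral.integral_comp_add_left (a := -h) (b := h)
      (fun x => (x - x₀) ^ 3 * q x) x₀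
    simpa [← sub_eq_add_neg] using this.symm
  rw [hsubst]
  set I := ∫ t in (-h)..h, t ^ 3 * q (x₀ + t)
  set b := iteratedDerivWithin 1 q s x₀
  calc _ = |1 / h * (I - 2 / 5 * h ^ 5 * b)| := by
        congr 1
        field_simp
    _ = 1 / h * |I - 2 / 5 * h ^ 5 * b| := by rw [abs_mul, abs_of_pos (by positivity)]
    _ ≤ 1 / h * (1 / 21 * h ^ 7 * M) := by gcongr
    _ = _ := by field_simp
end

section
/- Linear approximation of the truncated Gaussian mean: there exists a constant C > 0 such that for all μ ∈ ℝ and all L > 0 with L·(1 + |μ|) ≤ 1/2, one has |(∫_{μ−L}^{μ+L} (t − μ) φ(t) dt) / (∫_{μ−L}^{μ+L} φ(t) dt) + μ L² / 3| ≤ C · L⁴ · (1 + |μ|)³. -/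
open MeasureTheory Real

lemma stdNormalPDF_add (μ u : ℝ) :
    stdNormalPDF (μ + u) = stdNormalPDF μ * exp (-(μ * u) - u ^ 2 / 2) := by
  unfold stdNormalPDF
  rw [mul_assoc, ← Real.exp_add]
  ring_nf

lemma abs_exp_sub_quadratic_le {x : ℝ} (hx : |x| ≤ 1) :
    |exp x - (1 + x + x ^ 2 / 2)| ≤ |x| ^ 3 := by
  have h := Real.exp_bound hx (n := 3) (by norm_num)
  norm_num [Finset.sum_range_succ, Nat.factorial] at h
  linarith [pow_nonneg (abs_nonneg x) 3]

lemma abs_exponent_le {μ L u : ℝ} (hL : L ≤ 1) (hu : |u| ≤ L) :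
    |-(μ * u) - u ^ 2 / 2| ≤ L * (1 + |μ|) := by
  have h₁ : |μ * u| ≤ |μ| * L := by rw [abs_mul]; gcongr
  have h₂ : u ^ 2 ≤ L := by
    rw [← sq_abs]
    nlinarith [abs_nonneg u]
  rw [abs_le] at h₁ ⊢
  constructor <;> nlinarith [sq_nonneg u]

/-- The integral of `u + μL²/3` against the second-order expansion of `exp (-μu - u²/2)`. -/
lemma integral_mul_quadratic (μ L : ℝ) :
    ∫ u in (-L)..L, (u + μ * L ^ 2 / 3) *
      (1 + (-(μ * u) - u ^ 2 / 2) + (-(μ * u) - u ^ 2 / 2) ^ 2 / 2) =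
    L ^ 5 * (μ / 5 + μ * (μ ^ 2 - 1) / 9 + μ * L ^ 2 / 60) := by
  have hderiv (u : ℝ) : HasDerivAt (fun u : ℝ => μ * L ^ 2 / 3 * u
      + (1 - μ * L ^ 2 / 3 * μ) * (u ^ 2 / 2)
      + (-μ + μ * L ^ 2 / 3 * ((μ ^ 2 - 1) / 2)) * (u ^ 3 / 3)
      + ((μ ^ 2 - 1) / 2 + μ * L ^ 2 / 3 * (μ / 2)) * (u ^ 4 / 4)
      + (μ / 2 + μ * L ^ 2 / 3 / 8) * (u ^ 5 / 5) + 1 / 8 * (u ^ 6 / 6))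
      ((u + μ * L ^ 2 / 3) *
        (1 + (-(μ * u) - u ^ 2 / 2) + (-(μ * u) - u ^ 2 / 2) ^ 2 / 2)) u := by
    have hp (n : ℕ) (a b : ℝ) :
        HasDerivAt (fun u : ℝ => a * (u ^ n / b)) (a * (n * u ^ (n - 1) / b)) u :=
      ((hasDerivAt_pow n u).div_const b).const_mul a
    refine HasDerivAt.congr_deriv ((((((hasDerivAt_id u).const_mul (μ * L ^ 2 / 3)).add
      (hp 2 _ 2)).add (hp 3 _ 3)).add (hp 4 _ 4)).add (hp 5 _ 5) |>.add (hp 6 (1 / 8) 6)) ?_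
    push_cast
    ring
  rw [intervalIntegral.integral_eq_sub_of_hasDerivAt (fun u _ => hderiv u)
    (Continuous.intervalIntegrable (by fun_prop) _ _)]
  ring

lemma abs_integral_mul_quadratic_le {μ L : ℝ} (hL₀ : 0 ≤ L) (hL : L ≤ 1) :
    |∫ u in (-L)..L, (u + μ * L ^ 2 / 3) *
      (1 + (-(μ * u) - u ^ 2 / 2) + (-(μ * u) - u ^ 2 / 2) ^ 2 / 2)| ≤
    L ^ 5 * (1 + |μ|) ^ 3 := by
  rw [integral_mul_quadratic, abs_mul, abs_of_nonneg (pow_nonneg hL₀ 5)]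
  gcongr
  have hL2 : L ^ 2 ≤ 1 := pow_le_one₀ hL₀ hL
  have hfac : μ / 5 + μ * (μ ^ 2 - 1) / 9 + μ * L ^ 2 / 60 =
      μ * (4 / 45 + μ ^ 2 / 9 + L ^ 2 / 60) := by ring
  rw [hfac, abs_mul, abs_of_nonneg (a := 4 / 45 + μ ^ 2 / 9 + L ^ 2 / 60) (by positivity),
    ← sq_abs μ]
  have hμ := abs_nonneg μ
  nlinarith [mul_le_mul_of_nonneg_left hL2 hμ, pow_nonneg hμ 2, pow_nonneg hμ 3]

lemma abs_integral_mul_exp_le {μ L : ℝ} (hL : 0 < L) (h : L * (1 + |μ|) ≤ 1 / 2) :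
    |∫ u in (-L)..L, (u + μ * L ^ 2 / 3) * exp (-(μ * u) - u ^ 2 / 2)| ≤
      5 * L ^ 5 * (1 + |μ|) ^ 3 := by
  have hL₁ : L ≤ 1 := by nlinarith [abs_nonneg μ]
  have hrem : |∫ u in (-L)..L, (u + μ * L ^ 2 / 3) * (exp (-(μ * u) - u ^ 2 / 2) -
      (1 + (-(μ * u) - u ^ 2 / 2) + (-(μ * u) - u ^ 2 / 2) ^ 2 / 2))| ≤
      2 * L * (L * (1 + |μ|)) ^ 3 * |L - -L| := by
    rw [← Real.norm_eq_abs]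
    refine intervalIntegral.norm_integral_le_of_norm_le_const fun u hu => ?_
    rw [Set.uIoc_of_le (by linarith)] at hu
    have hu' : |u| ≤ L := abs_le.2 ⟨hu.1.le, hu.2⟩
    have hx := abs_exponent_le (μ := μ) hL₁ hu'
    rw [Real.norm_eq_abs, abs_mul]
    gcongr
    · have hc : |μ * L ^ 2 / 3| ≤ L := by
        rw [abs_div, abs_mul, abs_of_pos (pow_pos hL 2), abs_of_pos (by norm_num : (0 : ℝ) < 3)]
        nlinarith [abs_nonneg μ]
      linarith [abs_add_le u (μ * L ^ 2 / 3)]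
    · refine (abs_exp_sub_quadratic_le (by linarith)).trans ?_
      gcongr
  have hquad := abs_integral_mul_quadratic_le (μ := μ) hL.le hL₁
  simp only [mul_sub _ (exp _)] at hrem
  rw [intervalIntegral.integral_sub (Continuous.intervalIntegrable (by fun_prop) _ _)
    (Continuous.intervalIntegrable (by fun_prop) _ _), abs_of_pos (by linarith : 0 < L - -L)]
    at hrem
  have hsplit := abs_sub_le_iff.1 (hrem.trans_eq
    (by ring : _ = 4 * L ^ 5 * (1 + |μ|) ^ 3))
  rw [abs_le] at hquad ⊢
  constructor <;> linarith [hsplit.1, hsplit.2, hquad.1, hquad.2]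

lemma le_integral_exp {μ L : ℝ} (hL : 0 < L) (h : L * (1 + |μ|) ≤ 1 / 2) :
    L ≤ ∫ u in (-L)..L, exp (-(μ * u) - u ^ 2 / 2) := by
  have hL₁ : L ≤ 1 := by nlinarith [abs_nonneg μ]
  calc L = ∫ _ in (-L)..L, (1 / 2 : ℝ) := by
        rw [intervalIntegral.integral_const, smul_eq_mul]
        ring
    _ ≤ _ := by
        refine intervalIntegral.integral_mono_on (by linarith) (by simp)
          (Continuous.intervalIntegrable (by fun_prop) _ _) fun u hu => ?_
        have hx := abs_le.1 (abs_exponent_le (μ := μ) hL₁ (abs_le.2 hu))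
        linarith [Real.add_one_le_exp (-(μ * u) - u ^ 2 / 2)]

lemma integral_centered_mul_stdNormalPDF (f : ℝ → ℝ) (μ L : ℝ) :
    ∫ t in (μ - L)..(μ + L), f (t - μ) * stdNormalPDF t =
      stdNormalPDF μ * ∫ u in (-L)..L, f u * exp (-(μ * u) - u ^ 2 / 2) := by
  rw [sub_eq_add_neg, ← intervalIntegral.integral_comp_add_left,
    ← intervalIntegral.integral_const_mul]
  refine intervalIntegral.integral_congr fun u _ => ?_
  simp only [stdNormalPDF_add, add_sub_cancel_left]
  ring

/-- Linear approximation of the truncated Gaussian mean: there is a constant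
`C > 0` such that for all `μ ∈ ℝ` and `L > 0` with `L(1 + |μ|) ≤ 1/2`,
`|(∫_{μ−L}^{μ+L} (t − μ) φ(t) dt) / (∫_{μ−L}^{μ+L} φ(t) dt) + μL²/3|
  ≤ C L⁴ (1 + |μ|)³`. -/
theorem stmt_9 :
    ∃ C : ℝ, 0 < C ∧ ∀ μ L : ℝ, 0 < L → L * (1 + |μ|) ≤ 1 / 2 →
      |(∫ t in (μ - L)..(μ + L), (t - μ) * stdNormalPDF t) /
          (∫ t in (μ - L)..(μ + L), stdNormalPDF t) + μ * L ^ 2 / 3| ≤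
        C * L ^ 4 * (1 + |μ|) ^ 3 := by
  refine ⟨5, by norm_num, fun μ L hL h => ?_⟩
  have hpdf : stdNormalPDF μ ≠ 0 := by
    unfold stdNormalPDF
    positivity
  have hnum := integral_centered_mul_stdNormalPDF (fun u => u) μ L
  have hden := integral_centered_mul_stdNormalPDF (fun _ => 1) μ L
  simp only [one_mul] at hnum hden
  have hD := le_integral_exp hL h
  have hbound := abs_integral_mul_exp_le hL h
  simp only [add_mul _ _ (exp _)] at hbound
  rw [intervalIntegral.integral_add (Continuous.intervalIntegrable (by fun_prop) _ _)
    (Continuous.intervalIntegrable (by fun_prop) _ _),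
    intervalIntegral.integral_const_mul] at hbound
  rw [hnum, hden, mul_div_mul_left _ _ hpdf]
  set D := ∫ u in (-L)..L, exp (-(μ * u) - u ^ 2 / 2)
  have hD₀ : 0 < D := hL.trans_le hD
  rw [div_add' _ _ _ hD₀.ne', abs_div, abs_of_pos hD₀, div_le_iff₀ hD₀]
  calc _ ≤ 5 * L ^ 5 * (1 + |μ|) ^ 3 := hbound
    _ = 5 * L ^ 4 * (1 + |μ|) ^ 3 * L := by ring
    _ ≤ _ := by gcongr
end

section
/- Local weighted variance expansion: let x₀ ∈ ℝ and let q : ℝ → ℝ be a nonnegative function that is three times continuously differentiable on a neighborhood of x₀ with q(x₀) > 0. For h > 0 define m_j(h) = (1/h) ∫_{x₀−h}^{x₀+h} (x − x₀)^j q(x) dx for j = 0, 1, 2. Then there exist constants C > 0 and h₀ > 0 such that m₀(h) > 0 and | m₂(h) − m₁(h)² / m₀(h) − (2/3) h² q(x₀) | ≤ C h⁴ for all 0 < h ≤ h₀. -/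
open MeasureTheory

/-- First-order Taylor expansion with quadratic remainder at a point of class `C²`. -/
lemma ContDiffAt.exists_abs_taylor_one_le {q : ℝ → ℝ} {x₀ : ℝ} (hq : ContDiffAt ℝ 2 q x₀) :
    ∃ a K r : ℝ, 0 ≤ K ∧ 0 < r ∧ ContinuousOn q (Set.Icc (x₀ - r) (x₀ + r)) ∧
      ∀ x ∈ Set.Icc (x₀ - r) (x₀ + r), |q x - q x₀ - a * (x - x₀)| ≤ K * (x - x₀) ^ 2 := by
  have hq' : ContDiffAt ℝ 1 (deriv q) x₀ := by
    have hf : ContDiffAt ℝ 1 (fderiv ℝ q) x₀ := hq.fderiv_right (by norm_num)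
    exact hf.clm_apply contDiffAt_const
  obtain ⟨K, t, ht, hK⟩ := hq'.exists_lipschitzOnWith
  have hdiff : ∀ᶠ x in nhds x₀, DifferentiableAt ℝ q x :=
    (hq.eventually (by simp)).mono fun x hx => hx.differentiableAt (by simp)
  obtain ⟨r, hr, hball⟩ := Metric.nhds_basis_closedBall.mem_iff.1 (Filter.inter_mem ht hdiff)
  rw [Real.closedBall_eq_Icc] at hball
  refine ⟨deriv q x₀, K, r, K.2, hr,
    fun x hx => (hball hx).2.continuousAt.continuousWithinAt, fun x hx => ?_⟩
  have hx₀ : x₀ ∈ Set.Icc (x₀ - r) (x₀ + r) := ⟨by linarith, by linarith⟩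
  have hsub : Set.uIcc x₀ x ⊆ Set.Icc (x₀ - r) (x₀ + r) := Set.uIcc_subset_Icc hx₀ hx
  have hmv := (convex_uIcc x₀ x).norm_image_sub_le_of_norm_hasDerivWithin_le
    (f := fun y => q y - deriv q x₀ * y) (f' := fun y => deriv q y - deriv q x₀)
    (C := K * |x - x₀|)
    (fun y hy => by
      simpa using ((hball (hsub hy)).2.hasDerivAt.fun_sub
        ((hasDerivAt_id' y).const_mul (deriv q x₀))).hasDerivWithinAt)
    (fun y hy => by
      have hlip := hK.dist_le_mul y (hball (hsub hy)).1 x₀ (hball hx₀).1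
      rw [Real.dist_eq, Real.dist_eq] at hlip
      exact hlip.trans (mul_le_mul_of_nonneg_left (Set.abs_sub_left_of_mem_uIcc hy) K.2))
    Set.left_mem_uIcc Set.right_mem_uIcc
  rw [Real.norm_eq_abs, Real.norm_eq_abs, mul_assoc, abs_mul_abs_self] at hmv
  convert hmv using 1
  · congr 1; ring
  · ring

/-- Replacing a function by its affine approximation with quadratic remainder changes its scaled
`j`-th local moment by `O(h ^ (j + 2))`. -/
lemma abs_local_moment_sub_le {q : ℝ → ℝ} {x₀ a K r h : ℝ} (hK : 0 ≤ K)
    (hcont : ContinuousOn q (Set.Icc (x₀ - r) (x₀ + r)))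
    (hbound : ∀ x ∈ Set.Icc (x₀ - r) (x₀ + r), |q x - q x₀ - a * (x - x₀)| ≤ K * (x - x₀) ^ 2)
    (hh : 0 < h) (hhr : h ≤ r) (j : ℕ) :
    |(1 / h) * (∫ x in (x₀ - h)..(x₀ + h), (x - x₀) ^ j * q x) -
      (1 / h) * (q x₀ * ((h ^ (j + 1) - (-h) ^ (j + 1)) / (j + 1)) +
        a * ((h ^ (j + 2) - (-h) ^ (j + 2)) / (j + 2)))| ≤ 2 * K * h ^ (j + 2) := by
  have hle : x₀ - h ≤ x₀ + h := by linarith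
  have hsub : Set.Icc (x₀ - h) (x₀ + h) ⊆ Set.Icc (x₀ - r) (x₀ + r) :=
    Set.Icc_subset_Icc (by linarith) (by linarith)
  have hpow (n : ℕ) : ∫ x in (x₀ - h)..(x₀ + h), (x - x₀) ^ n =
      (h ^ (n + 1) - (-h) ^ (n + 1)) / (n + 1) := by
    rw [intervalIntegral.integral_comp_sub_right (fun x => x ^ n), integral_pow]
    congr <;> ring
  have hint : IntervalIntegrable (fun x => (x - x₀) ^ j * q x) volume (x₀ - h) (x₀ + h) := by
    apply ContinuousOn.intervalIntegrable
    rw [Set.uIcc_of_le hle]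
    exact (by fun_prop : Continuous fun x : ℝ => (x - x₀) ^ j).continuousOn.mul (hcont.mono hsub)
  have hpoly : ∫ x in (x₀ - h)..(x₀ + h), (q x₀ * (x - x₀) ^ j + a * (x - x₀) ^ (j + 1)) =
      q x₀ * ((h ^ (j + 1) - (-h) ^ (j + 1)) / (j + 1)) +
        a * ((h ^ (j + 2) - (-h) ^ (j + 2)) / (j + 2)) := by
    rw [intervalIntegral.integral_add
      (Continuous.intervalIntegrable (by fun_prop) _ _)
      (Continuous.intervalIntegrable (by fun_prop) _ _),
      intervalIntegral.integral_const_mul, intervalIntegral.integral_const_mul, hpow, hpow]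
    push_cast
    ring_nf
  rw [← mul_sub, ← hpoly, ← intervalIntegral.integral_sub hint
    (Continuous.intervalIntegrable (by fun_prop) _ _), abs_mul, abs_of_pos (by positivity)]
  have hnorm := intervalIntegral.norm_integral_le_of_norm_le_const
    (a := x₀ - h) (b := x₀ + h) (C := K * h ^ (j + 2))
    (f := fun x => (x - x₀) ^ j * q x - (q x₀ * (x - x₀) ^ j + a * (x - x₀) ^ (j + 1)))
    (fun x hx => by
      rw [Set.uIoc_of_le hle] at hx
      have hxh : |x - x₀| ≤ h := abs_le.2 ⟨by linarith [hx.1], by linarith [hx.2]⟩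
      have hR := hbound x (hsub (Set.Ioc_subset_Icc_self hx))
      rw [← sq_abs (x - x₀)] at hR
      calc _ = |x - x₀| ^ j * |q x - q x₀ - a * (x - x₀)| := by
            rw [Real.norm_eq_abs, ← abs_pow, ← abs_mul]; congr 1; ring
        _ ≤ |x - x₀| ^ j * (K * |x - x₀| ^ 2) := by gcongr
        _ = K * |x - x₀| ^ (j + 2) := by ring
        _ ≤ K * h ^ (j + 2) := by gcongr)
  rw [Real.norm_eq_abs, show x₀ + h - (x₀ - h) = 2 * h by ring, abs_of_pos (by positivity : 0 < 2 * h)]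
    at hnorm
  calc _ ≤ 1 / h * (K * h ^ (j + 2) * (2 * h)) := by gcongr
    _ = 2 * K * h ^ (j + 2) := by field_simp

/-- Local weighted variance expansion: if `q ≥ 0` is three times continuously
differentiable on a neighborhood of `x₀` with `q(x₀) > 0`, and
`m_j(h) = (1/h) ∫_{x₀−h}^{x₀+h} (x − x₀)^j q(x) dx`, then there are `C > 0` and
`h₀ > 0` such that for all `0 < h ≤ h₀`, `m₀(h) > 0` and
`|m₂(h) − m₁(h)²/m₀(h) − (2/3)h²q(x₀)| ≤ C h⁴`. -/
theorem stmt_14 (x₀ : ℝ) (q : ℝ → ℝ) (hq_nonneg : ∀ x, 0 ≤ q x)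
    (U : Set ℝ) (hU : U ∈ nhds x₀) (hq : ContDiffOn ℝ 3 q U)
    (hq₀ : 0 < q x₀) :
    ∃ C : ℝ, 0 < C ∧ ∃ h₀ : ℝ, 0 < h₀ ∧ ∀ h : ℝ, 0 < h → h ≤ h₀ →
      (0 < (1 / h) * ∫ x in (x₀ - h)..(x₀ + h), q x) ∧
      |(1 / h) * (∫ x in (x₀ - h)..(x₀ + h), (x - x₀) ^ 2 * q x) -
          ((1 / h) * ∫ x in (x₀ - h)..(x₀ + h), (x - x₀) * q x) ^ 2 /
            ((1 / h) * ∫ x in (x₀ - h)..(x₀ + h), q x) -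
          (2 / 3) * h ^ 2 * q x₀| ≤ C * h ^ 4 := by
  obtain ⟨a, K, r, hK, hr, hcont, hbound⟩ :=
    ((hq.contDiffAt hU).of_le (by norm_num)).exists_abs_taylor_one_le
  set M : ℝ := |a| + 2 * K with hM
  have hM0 : 0 ≤ M := by positivity
  refine ⟨2 * K + M ^ 2 / q x₀ + 1, by positivity, min (min r 1) (q x₀ / (2 * (K + 1))),
    by positivity, fun h hh hle => ?_⟩
  have hhr : h ≤ r := hle.trans ((min_le_left _ _).trans (min_le_left _ _))
  have hh1 : h ≤ 1 := hle.trans ((min_le_left _ _).trans (min_le_right _ _))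
  have hhK : h * (2 * (K + 1)) ≤ q x₀ :=
    (le_div_iff₀ (by positivity)).1 (hle.trans (min_le_right _ _))
  have h0 := abs_local_moment_sub_le hK hcont hbound hh hhr 0
  have h1 := abs_local_moment_sub_le hK hcont hbound hh hhr 1
  have h2 := abs_local_moment_sub_le hK hcont hbound hh hhr 2
  simp only [pow_zero, one_mul, pow_one] at h0 h1
  set m₀ := (1 / h) * ∫ x in (x₀ - h)..(x₀ + h), q x
  set m₁ := (1 / h) * ∫ x in (x₀ - h)..(x₀ + h), (x - x₀) * q x
  set m₂ := (1 / h) * ∫ x in (x₀ - h)..(x₀ + h), (x - x₀) ^ 2 * q x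
  have e0 : |m₀ - 2 * q x₀| ≤ 2 * K * h ^ 2 := by
    convert h0 using 3
    push_cast; field_simp; ring
  have e1 : |m₁ - 2 / 3 * a * h ^ 2| ≤ 2 * K * h ^ 3 := by
    convert h1 using 3
    push_cast; field_simp; ring
  have e2 : |m₂ - 2 / 3 * h ^ 2 * q x₀| ≤ 2 * K * h ^ 4 := by
    convert h2 using 3
    push_cast; field_simp; ring
  have hm0 : q x₀ ≤ m₀ := by
    have hKh : K * h ^ 2 ≤ K * h := by
      have : h ^ 2 ≤ h := by nlinarith
      gcongr
    linarith [(abs_le.1 e0).1]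
  have hm1 : |m₁| ≤ M * h ^ 2 := by
    have hKh : K * h ^ 3 ≤ K * h ^ 2 := by
      have : h ^ 3 ≤ h ^ 2 := pow_le_pow_of_le_one hh.le hh1 (by norm_num)
      gcongr
    have htri := abs_sub_abs_le_abs_sub m₁ (2 / 3 * a * h ^ 2)
    rw [abs_mul (2 / 3 * a), abs_mul (2 / 3), abs_of_pos (by norm_num : (0 : ℝ) < 2 / 3),
      abs_of_nonneg (sq_nonneg h)] at htri
    have : 0 ≤ |a| * h ^ 2 := by positivity
    rw [hM]
    linarith
  have hpos : 0 < m₀ := hq₀.trans_le hm0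
  have hcorr : |m₁ ^ 2 / m₀| ≤ M ^ 2 / q x₀ * h ^ 4 := by
    rw [abs_of_nonneg (by positivity), ← sq_abs m₁]
    calc |m₁| ^ 2 / m₀ ≤ (M * h ^ 2) ^ 2 / q x₀ := by gcongr
      _ = M ^ 2 / q x₀ * h ^ 4 := by ring
  refine ⟨hpos, ?_⟩
  calc |m₂ - m₁ ^ 2 / m₀ - 2 / 3 * h ^ 2 * q x₀|
      = |(m₂ - 2 / 3 * h ^ 2 * q x₀) - m₁ ^ 2 / m₀| := by congr 1; ring
    _ ≤ |m₂ - 2 / 3 * h ^ 2 * q x₀| + |m₁ ^ 2 / m₀| := abs_sub _ _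
    _ ≤ (2 * K + M ^ 2 / q x₀ + 1) * h ^ 4 := by
      have : 0 ≤ h ^ 4 := by positivity
      linarith
end

section
/- Kernel-average accuracy for a Gaussian density: let m ∈ ℝ, σ > 0, and let q(x) = (1/σ) φ((x − m)/σ) be the N(m, σ²) density. Let x₀ ∈ ℝ, h > 0, and set u = (|x₀ − m| + h)/σ. Then | (1/h) ∫_{x₀−h}^{x₀+h} q(x) dx − 2 q(x₀) | ≤ (2/3) (h²/σ²) (1 + u²) exp(u h / σ) · q(x₀). -/
open MeasureTheory Real

/-- A symmetric second-difference bound controls the error of the midpoint rule. -/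
theorem abs_integral_sub_midpoint_le {f : ℝ → ℝ} (hf : Continuous f) {x₀ h C : ℝ} (hh : 0 ≤ h)
    (hC : ∀ t ∈ Set.Icc 0 h, |f (x₀ + t) + f (x₀ - t) - 2 * f x₀| ≤ C * t ^ 2) :
    |(∫ x in (x₀ - h)..(x₀ + h), f x) - 2 * h * f x₀| ≤ C * (h ^ 3 / 3) := by
  have hsplit : (∫ x in (x₀ - h)..(x₀ + h), f x) - 2 * h * f x₀ =
      ∫ t in (0 : ℝ)..h, (f (x₀ + t) + f (x₀ - t) - 2 * f x₀) := by
    rw [intervalIntegral.integral_sub, intervalIntegral.integral_add,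
      intervalIntegral.integral_comp_add_left, intervalIntegral.integral_comp_sub_left,
      intervalIntegral.integral_const, ← intervalIntegral.integral_add_adjacent_intervals
        (hf.intervalIntegrable (x₀ - h) x₀) (hf.intervalIntegrable x₀ (x₀ + h))]
    · simp only [add_zero, sub_zero, smul_eq_mul]
      ring
    all_goals exact Continuous.intervalIntegrable (by fun_prop) _ _
  have hsq : ∫ t in (0 : ℝ)..h, C * t ^ 2 = C * (h ^ 3 / 3) := by
    rw [intervalIntegral.integral_const_mul, integral_pow]
    norm_num
  rw [hsplit, ← hsq, ← Real.norm_eq_abs]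
  refine intervalIntegral.norm_integral_le_of_norm_le hh (Filter.Eventually.of_forall ?_)
    (Continuous.intervalIntegrable (by fun_prop) _ _)
  exact fun t ht => hC t ⟨ht.1.le, ht.2⟩

theorem exp_add_exp_neg_sub_two_le {y : ℝ} (hy : 0 ≤ y) :
    Real.exp y + Real.exp (-y) - 2 ≤ y ^ 2 * Real.exp y := by
  have hmul : Real.exp y * Real.exp (-y) = 1 := by rw [← Real.exp_add]; simp
  have hle : 1 - Real.exp (-y) ≤ y := by linarith [Real.add_one_le_exp (-y)]
  have hnonneg : 0 ≤ 1 - Real.exp (-y) := by simpa using hy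
  calc Real.exp y + Real.exp (-y) - 2 = (1 - Real.exp (-y)) ^ 2 * Real.exp y := by
        linear_combination (2 - Real.exp (-y)) * hmul
    _ ≤ y ^ 2 * Real.exp y := by gcongr

/-- The symmetric second difference of the standard normal density. -/
theorem abs_stdNormalPDF_second_diff_le (a s : ℝ) :
    |stdNormalPDF (a + s) + stdNormalPDF (a - s) - 2 * stdNormalPDF a| ≤
      s ^ 2 * (1 + a ^ 2) * Real.exp (|a * s|) * stdNormalPDF a := by
  have hpos : 0 < stdNormalPDF a := by unfold stdNormalPDF; positivity
  have hshift (r : ℝ) : stdNormalPDF (a + r) =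
      stdNormalPDF a * (Real.exp (-r ^ 2 / 2) * Real.exp (-(a * r))) := by
    unfold stdNormalPDF
    rw [mul_assoc, ← Real.exp_add, ← Real.exp_add]
    ring_nf
  have hsum : Real.exp (-(a * s)) + Real.exp (a * s) =
      Real.exp |a * s| + Real.exp (-|a * s|) := by
    rcases abs_cases (a * s) with ⟨h, -⟩ | ⟨h, -⟩ <;> rw [h] <;> simp [add_comm]
  have hfactor : stdNormalPDF (a + s) + stdNormalPDF (a - s) - 2 * stdNormalPDF a =
      (Real.exp (-s ^ 2 / 2) * (Real.exp |a * s| + Real.exp (-|a * s|)) - 2) *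
        stdNormalPDF a := by
    have hneg := hshift (-s)
    rw [neg_sq, mul_neg, neg_neg, ← sub_eq_add_neg] at hneg
    rw [hshift, hneg, ← hsum]
    ring
  rw [hfactor, abs_mul, abs_of_pos hpos]
  refine mul_le_mul_of_nonneg_right ?_ hpos.le
  have hdiff := exp_add_exp_neg_sub_two_le (abs_nonneg (a * s))
  rw [sq_abs] at hdiff
  have htwo : 2 ≤ Real.exp |a * s| + Real.exp (-|a * s|) := by
    linarith [Real.add_one_le_exp |a * s|, Real.add_one_le_exp (-|a * s|)]
  have hdamp_le : Real.exp (-s ^ 2 / 2) ≤ 1 := Real.exp_le_one_iff.2 (by nlinarith [sq_nonneg s])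
  have hdamp_ge : 1 - s ^ 2 / 2 ≤ Real.exp (-s ^ 2 / 2) := by
    linarith [Real.add_one_le_exp (-s ^ 2 / 2)]
  have hexp : 1 ≤ Real.exp |a * s| := Real.one_le_exp (abs_nonneg _)
  have hs : s ^ 2 ≤ s ^ 2 * Real.exp |a * s| := le_mul_of_one_le_right (sq_nonneg s) hexp
  have has : 0 ≤ (a * s) ^ 2 * Real.exp |a * s| := by positivity
  have hbound : s ^ 2 * (1 + a ^ 2) * Real.exp |a * s| =
      s ^ 2 * Real.exp |a * s| + (a * s) ^ 2 * Real.exp |a * s| := by ring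
  rw [hbound, abs_le]
  constructor
  · nlinarith [mul_le_mul_of_nonneg_left htwo (Real.exp_pos (-s ^ 2 / 2)).le]
  · nlinarith [mul_le_mul_of_nonneg_right hdamp_le (zero_le_two.trans htwo), sq_nonneg s]

/-- Kernel-average accuracy for a Gaussian density: if
`q(x) = (1/σ)φ((x − m)/σ)` is the `N(m, σ²)` density and
`u = (|x₀ − m| + h)/σ`, then
`|(1/h) ∫_{x₀−h}^{x₀+h} q − 2q(x₀)| ≤ (2/3)(h²/σ²)(1 + u²) exp(uh/σ) q(x₀)`. -/
theorem stmt_16 (m σ : ℝ) (hσ : 0 < σ) (q : ℝ → ℝ)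
    (hq : ∀ x, q x = (1 / σ) * stdNormalPDF ((x - m) / σ))
    (x₀ h : ℝ) (hh : 0 < h) (u : ℝ) (hu : u = (|x₀ - m| + h) / σ) :
    |(1 / h) * (∫ x in (x₀ - h)..(x₀ + h), q x) - 2 * q x₀| ≤
      (2 / 3) * (h ^ 2 / σ ^ 2) * (1 + u ^ 2) * Real.exp (u * h / σ) * q x₀ := by
  have hqc : Continuous q := by
    rw [funext hq]
    unfold stdNormalPDF
    fun_prop
  have hq₀ : 0 < q x₀ := by
    rw [hq, stdNormalPDF]
    positivity
  set K := (1 + u ^ 2) * Real.exp (u * h / σ) * q x₀ with hK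
  have hKpos : 0 < K := by positivity
  have hau : |(x₀ - m) / σ| ≤ u := by
    rw [hu, abs_div, abs_of_pos hσ]
    gcongr
    linarith
  have hdiff : ∀ t ∈ Set.Icc 0 h,
      |q (x₀ + t) + q (x₀ - t) - 2 * q x₀| ≤ K / σ ^ 2 * t ^ 2 := by
    rintro t ⟨ht₀, hth⟩
    have hprod : |(x₀ - m) / σ * (t / σ)| ≤ u * h / σ := by
      rw [abs_mul, abs_of_nonneg (div_nonneg ht₀ hσ.le), mul_div_assoc]
      gcongr
      exact (abs_nonneg _).trans hau
    have hsq : ((x₀ - m) / σ) ^ 2 ≤ u ^ 2 := sq_le_sq.2 (hau.trans (le_abs_self u))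
    have hscale : q (x₀ + t) + q (x₀ - t) - 2 * q x₀ =
        1 / σ * (stdNormalPDF ((x₀ - m) / σ + t / σ) + stdNormalPDF ((x₀ - m) / σ - t / σ) -
          2 * stdNormalPDF ((x₀ - m) / σ)) := by
      rw [hq, hq, hq, ← add_div, ← sub_div, add_sub_right_comm x₀ t m,
        sub_right_comm x₀ t m]
      ring
    rw [hscale, abs_mul, abs_of_pos (one_div_pos.2 hσ)]
    calc _ ≤ 1 / σ * ((t / σ) ^ 2 * (1 + ((x₀ - m) / σ) ^ 2) *
          Real.exp |(x₀ - m) / σ * (t / σ)| * stdNormalPDF ((x₀ - m) / σ)) := by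
          gcongr
          exact abs_stdNormalPDF_second_diff_le _ _
      _ = (t / σ) ^ 2 * ((1 + ((x₀ - m) / σ) ^ 2) *
          Real.exp |(x₀ - m) / σ * (t / σ)| * q x₀) := by rw [hq]; ring
      _ ≤ (t / σ) ^ 2 * K := by rw [hK]; gcongr
      _ = K / σ ^ 2 * t ^ 2 := by ring
  have hmid := abs_integral_sub_midpoint_le hqc hh.le hdiff
  calc |(1 / h) * (∫ x in (x₀ - h)..(x₀ + h), q x) - 2 * q x₀|
      = 1 / h * |(∫ x in (x₀ - h)..(x₀ + h), q x) - 2 * h * q x₀| := by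
        rw [← abs_of_pos (one_div_pos.2 hh), ← abs_mul, abs_of_pos (one_div_pos.2 hh)]
        congr 1
        field_simp
    _ ≤ 1 / h * (K / σ ^ 2 * (h ^ 3 / 3)) := by gcongr
    _ = 1 / 3 * (h ^ 2 / σ ^ 2 * K) := by field_simp
    _ ≤ 2 / 3 * (h ^ 2 / σ ^ 2 * K) := by gcongr; norm_num
    _ = _ := by rw [hK]; ring
end
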